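/- Let S be an inverse semigroup and N a normal inverse subsemigroup of S. Suppose s, s₁, t ∈ S with s ≃_N s₁ and s⁻¹ s ≃_N t t⁻¹ (so also s₁⁻¹ s₁ ≃_N t t⁻¹). Let a ∈ N satisfy a a⁻¹ ≤ s⁻¹ s and a⁻¹ a = t t⁻¹, and let a₁ ∈ N satisfy a₁ a₁⁻¹ ≤ s₁⁻¹ s₁ and a₁⁻¹ a₁ = t t⁻¹. Then s a t ≃_N s₁ a₁ t; that is, the ≃_N-class of s a t depends only on the ≃_N-class of s. -/

import Mathlib

/-- An inverse semigroup: a semigroup in which every element `s` has a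
(unique) inverse `s⁻¹` with `s * s⁻¹ * s = s` and `s⁻¹ * s * s⁻¹ = s⁻¹`. -/
class InverseSemigroup (S : Type*) extends Semigroup S, Inv S where
  mul_inv_mul : ∀ s : S, s * s⁻¹ * s = s
  inv_mul_inv : ∀ s : S, s⁻¹ * s * s⁻¹ = s⁻¹
  inv_unique : ∀ s t : S, s * t * s = s → t * s * t = t → t = s⁻¹

/-- The natural partial order on an inverse semigroup:
`s ≤ t` iff `s = e * t` for some idempotent `e`. -/
def NatLe {S : Type*} [InverseSemigroup S] (s t : S) : Prop :=
  ∃ e : S, IsIdempotentElem e ∧ s = e * t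

/-- A normal inverse subsemigroup: a full inverse subsemigroup that is
closed under conjugation. -/
structure IsNormalInverseSubsemigroup {S : Type*} [InverseSemigroup S] (N : Set S) : Prop where
  mul_mem : ∀ {a b : S}, a ∈ N → b ∈ N → a * b ∈ N
  inv_mem : ∀ {a : S}, a ∈ N → a⁻¹ ∈ N
  full : ∀ {e : S}, IsIdempotentElem e → e ∈ N
  conj_mem : ∀ (s : S) {n : S}, n ∈ N → s⁻¹ * n * s ∈ N

/-- The preorder `≤_N` associated to a normal inverse subsemigroup `N`:
`s ≤_N t` iff there are `a, b ∈ N` with `a⁻¹ * a = s * s⁻¹`,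
`s⁻¹ * s = b * b⁻¹` (so `a · s · b` is a trace product) and `a * s * b ≤ t`. -/
def LeN {S : Type*} [InverseSemigroup S] (N : Set S) (s t : S) : Prop :=
  ∃ a ∈ N, ∃ b ∈ N, a⁻¹ * a = s * s⁻¹ ∧ s⁻¹ * s = b * b⁻¹ ∧ NatLe (a * s * b) t

/-- The equivalence `≃_N` obtained by symmetrizing `≤_N`. -/
def SimeqN {S : Type*} [InverseSemigroup S] (N : Set S) (s t : S) : Prop :=
  LeN N s t ∧ LeN N t s

namespace InverseSemigroup

variable {S : Type*} [InverseSemigroup S]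

protected theorem inv_inv (s : S) : s⁻¹⁻¹ = s :=
  (inv_unique _ _ (inv_mul_inv s) (mul_inv_mul s)).symm

theorem isIdempotentElem_mul_inv (s : S) : IsIdempotentElem (s * s⁻¹) := by
  rw [IsIdempotentElem, ← mul_assoc, mul_inv_mul]

theorem isIdempotentElem_inv_mul (s : S) : IsIdempotentElem (s⁻¹ * s) := by
  rw [IsIdempotentElem, ← mul_assoc, inv_mul_inv]

theorem inv_eq_of_isIdempotentElem {e : S} (he : IsIdempotentElem e) : e⁻¹ = e :=
  (inv_unique _ _ (by rw [he.eq, he.eq]) (by rw [he.eq, he.eq])).symm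

theorem isIdempotentElem_mul {e f : S} (he : IsIdempotentElem e) (hf : IsIdempotentElem f) :
    IsIdempotentElem (e * f) := by
  have hx := inv_mul_inv (e * f)
  have hx' := mul_inv_mul (e * f)
  set x := (e * f)⁻¹ with hxdef
  have he' (z : S) : e * (e * z) = e * z := by rw [← mul_assoc, he.eq]
  have hf' (z : S) : f * (f * z) = f * z := by rw [← mul_assoc, hf.eq]
  have key : f * x * e = x := by
    refine inv_unique (e * f) _ ?_ ?_
    · simpa only [mul_assoc, he', hf'] using hx'
    · calc f * x * e * (e * f) * (f * x * e) = f * (x * (e * f) * x) * e := by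
            simp only [mul_assoc, he', hf']
        _ = f * x * e := by rw [hx]
  have hidem : IsIdempotentElem x := by
    calc x * x = f * x * e * (f * x * e) := by rw [key]
      _ = f * (x * (e * f) * x) * e := by simp only [mul_assoc]
      _ = x := by rw [hx, key]
  have : e * f = x := by
    rw [← InverseSemigroup.inv_inv (e * f), ← hxdef, inv_eq_of_isIdempotentElem hidem]
  rwa [this]

theorem mul_comm_of_isIdempotentElem {e f : S} (he : IsIdempotentElem e)
    (hf : IsIdempotentElem f) : e * f = f * e := by
  have he' (z : S) : e * (e * z) = e * z := by rw [← mul_assoc, he.eq]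
  have hf' (z : S) : f * (f * z) = f * z := by rw [← mul_assoc, hf.eq]
  have hef := isIdempotentElem_mul he hf
  have hfe := isIdempotentElem_mul hf he
  rw [← inv_eq_of_isIdempotentElem hef]
  refine (inv_unique _ _ ?_ ?_).symm
  · simpa only [IsIdempotentElem, mul_assoc, he', hf'] using hef
  · simpa only [IsIdempotentElem, mul_assoc, he', hf'] using hfe

protected theorem mul_inv_rev (s t : S) : (s * t)⁻¹ = t⁻¹ * s⁻¹ := by
  have hc := mul_comm_of_isIdempotentElem (isIdempotentElem_mul_inv t) (isIdempotentElem_inv_mul s)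
  refine (inv_unique _ _ ?_ ?_).symm
  · calc s * t * (t⁻¹ * s⁻¹) * (s * t) = s * ((t * t⁻¹) * (s⁻¹ * s)) * t := by
          simp only [mul_assoc]
      _ = (s * s⁻¹ * s) * (t * t⁻¹ * t) := by rw [hc]; simp only [mul_assoc]
      _ = s * t := by rw [mul_inv_mul, mul_inv_mul]
  · calc t⁻¹ * s⁻¹ * (s * t) * (t⁻¹ * s⁻¹) = t⁻¹ * ((s⁻¹ * s) * (t * t⁻¹)) * s⁻¹ := by
          simp only [mul_assoc]
      _ = (t⁻¹ * t * t⁻¹) * (s⁻¹ * s * s⁻¹) := by rw [← hc]; simp only [mul_assoc]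
      _ = t⁻¹ * s⁻¹ := by rw [inv_mul_inv, inv_mul_inv]

/-- An element below `t` is the restriction of `t` to its domain. -/
theorem eq_mul_inv_mul_of_natLe {u t : S} (h : NatLe u t) : u = t * (u⁻¹ * u) := by
  obtain ⟨e, he, rfl⟩ := h
  have hc := mul_comm_of_isIdempotentElem (isIdempotentElem_mul_inv t) he
  calc e * t = e * (t * t⁻¹) * t := by rw [mul_assoc, mul_inv_mul]
    _ = t * t⁻¹ * (e * e) * t := by rw [← hc, he.eq]
    _ = t * ((e * t)⁻¹ * (e * t)) := by
      rw [InverseSemigroup.mul_inv_rev, inv_eq_of_isIdempotentElem he]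
      simp only [mul_assoc]

theorem natLe_refl (s : S) : NatLe s s :=
  ⟨s * s⁻¹, isIdempotentElem_mul_inv s, (mul_inv_mul s).symm⟩

/-- If the range of `a` lies in the domain of `s`, then the domain projection of `s` fixes `a`. -/
theorem inv_mul_mul_of_natLe {s a : S} (h : NatLe (a * a⁻¹) (s⁻¹ * s)) : s⁻¹ * s * a = a := by
  have hs := isIdempotentElem_inv_mul s
  have h' := eq_mul_inv_mul_of_natLe h
  have h1 : s⁻¹ * s * (a * a⁻¹) = a * a⁻¹ := by
    rw [h', ← mul_assoc, hs.eq]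
  rw [← mul_inv_mul a, ← mul_assoc, h1]

end InverseSemigroup

open InverseSemigroup in
/-- If `s ≤_N s₁` then `s * a * t ≤_N s₁ * a₁ * t`; the left witness is
`(s₁ * a₁) * (s * a)⁻¹`. -/
theorem LeN.comp {S : Type*} [InverseSemigroup S] {N : Set S}
    (hN : IsNormalInverseSubsemigroup N) {s s₁ t a a₁ : S} (hs : LeN N s s₁)
    (ha : a ∈ N) (ha1 : NatLe (a * a⁻¹) (s⁻¹ * s)) (ha2 : a⁻¹ * a = t * t⁻¹)
    (ha₁ : a₁ ∈ N) (ha₁1 : NatLe (a₁ * a₁⁻¹) (s₁⁻¹ * s₁)) (ha₁2 : a₁⁻¹ * a₁ = t * t⁻¹) :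
    LeN N (s * a * t) (s₁ * a₁ * t) := by
  obtain ⟨p, hp, q, hq, hps, hsq, hle⟩ := hs
  have hsa := inv_mul_mul_of_natLe ha1
  have hsa₁ := inv_mul_mul_of_natLe ha₁1
  have hrange : (p * s * q)⁻¹ * (p * s * q) = q⁻¹ * q := by
    calc (p * s * q)⁻¹ * (p * s * q) = q⁻¹ * (s⁻¹ * (p⁻¹ * p) * s) * q := by
          simp only [InverseSemigroup.mul_inv_rev, mul_assoc]
      _ = q⁻¹ * (s⁻¹ * s * s⁻¹ * s) * q := by rw [hps]; simp only [mul_assoc]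
      _ = q⁻¹ * q * q⁻¹ * q := by rw [inv_mul_inv, hsq]; simp only [mul_assoc]
      _ = q⁻¹ * q := by rw [inv_mul_inv]
  have hpsq : p * s = s₁ * q⁻¹ := by
    have h := eq_mul_inv_mul_of_natLe hle
    rw [hrange] at h
    calc p * s = p * (s * s⁻¹ * s) := by rw [mul_inv_mul]
      _ = p * s * (s⁻¹ * s) := by simp only [mul_assoc]
      _ = p * s * q * q⁻¹ := by rw [hsq]; simp only [mul_assoc]
      _ = s₁ * (q⁻¹ * q * q⁻¹) := by rw [h]; simp only [mul_assoc]
      _ = s₁ * q⁻¹ := by rw [inv_mul_inv]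
  have hinv : q * s₁⁻¹ * p = s⁻¹ := by
    have h := congrArg (·⁻¹) hpsq
    simp only [InverseSemigroup.mul_inv_rev, InverseSemigroup.inv_inv] at h
    rw [← h, mul_assoc, hps, ← mul_assoc, inv_mul_inv]
  have hmem : s₁ * a₁ * a⁻¹ * s⁻¹ ∈ N := by
    have h := hN.mul_mem
      (hN.conj_mem s₁⁻¹ (hN.mul_mem (hN.mul_mem ha₁ (hN.inv_mem ha)) hq)) hp
    rw [InverseSemigroup.inv_inv] at h
    rw [← hinv]
    simpa only [mul_assoc] using h
  refine ⟨_, hmem, t⁻¹ * t, hN.full (isIdempotentElem_inv_mul t), ?_, ?_, ?_⟩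
  · calc (s₁ * a₁ * a⁻¹ * s⁻¹)⁻¹ * (s₁ * a₁ * a⁻¹ * s⁻¹)
          = s * a * (a₁⁻¹ * (s₁⁻¹ * s₁ * a₁)) * a⁻¹ * s⁻¹ := by
          simp only [InverseSemigroup.mul_inv_rev, InverseSemigroup.inv_inv, mul_assoc]
      _ = s * a * (t * t⁻¹) * a⁻¹ * s⁻¹ := by rw [hsa₁, ha₁2]
      _ = s * a * t * (s * a * t)⁻¹ := by
          simp only [InverseSemigroup.mul_inv_rev, mul_assoc]
  · calc (s * a * t)⁻¹ * (s * a * t) = t⁻¹ * (a⁻¹ * (s⁻¹ * s * a)) * t := by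
          simp only [InverseSemigroup.mul_inv_rev, mul_assoc]
      _ = t⁻¹ * t * (t⁻¹ * t) := by rw [hsa, ha2]; simp only [mul_assoc]
      _ = t⁻¹ * t * (t⁻¹ * t)⁻¹ := by
          rw [inv_eq_of_isIdempotentElem (isIdempotentElem_inv_mul t)]
  · have h : s₁ * a₁ * a⁻¹ * s⁻¹ * (s * a * t) * (t⁻¹ * t) = s₁ * a₁ * t := by
      calc _ = s₁ * a₁ * (a⁻¹ * (s⁻¹ * s * a)) * (t * t⁻¹ * t) := by simp only [mul_assoc]
        _ = s₁ * (a₁ * (a₁⁻¹ * a₁)) * t := by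
          rw [mul_inv_mul, hsa, ha2, ← ha₁2]; simp only [mul_assoc]
        _ = s₁ * a₁ * t := by rw [← mul_assoc a₁, mul_inv_mul]
    rw [h]
    exact natLe_refl _

/-- The `≃_N`-class of `s * a * t` depends only on the `≃_N`-class of `s`. -/
theorem simeqN_comp_indep_of_class {S : Type*} [InverseSemigroup S] {N : Set S}
    (hN : IsNormalInverseSubsemigroup N) {s s₁ t a a₁ : S}
    (hss₁ : SimeqN N s s₁)
    (h : SimeqN N (s⁻¹ * s) (t * t⁻¹))
    (ha : a ∈ N) (ha1 : NatLe (a * a⁻¹) (s⁻¹ * s)) (ha2 : a⁻¹ * a = t * t⁻¹)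
    (ha₁ : a₁ ∈ N) (ha₁1 : NatLe (a₁ * a₁⁻¹) (s₁⁻¹ * s₁)) (ha₁2 : a₁⁻¹ * a₁ = t * t⁻¹) :
    SimeqN N (s * a * t) (s₁ * a₁ * t) :=
  ⟨hss₁.1.comp hN ha ha1 ha2 ha₁ ha₁1 ha₁2, hss₁.2.comp hN ha₁ ha₁1 ha₁2 ha ha1 ha2⟩
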